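/- Let I be a proper *-ideal of ℂ[X₁,…,Xₙ]. Then the following are equivalent: (i) I is a set ideal, i.e., there exists a subset Z of ℝⁿ such that I = I_ℂ(Z); (ii) there exists a positive definite linear functional Λ on ℂ[X₁,…,Xₙ] such that N(Λ) = I. -/

import Mathlib

open MeasureTheory
open scoped ComplexOrder

noncomputable def evalC {n : ℕ} (P : MvPolynomial (Fin n) ℂ) (x : Fin n → ℝ) : ℂ :=
  MvPolynomial.aeval (fun i => (x i : ℂ)) P

noncomputable def starC {n : ℕ} (P : MvPolynomial (Fin n) ℂ) : MvPolynomial (Fin n) ℂ :=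
  MvPolynomial.map (starRingEnd ℂ) P

def IsPosDefC {n : ℕ} (Λ : MvPolynomial (Fin n) ℂ →ₗ[ℂ] ℂ) : Prop :=
  ∀ P : MvPolynomial (Fin n) ℂ, 0 ≤ Λ (starC P * P)

def IsMomentC {n : ℕ} (Λ : MvPolynomial (Fin n) ℂ →ₗ[ℂ] ℂ) : Prop :=
  ∃ μ : Measure (Fin n → ℝ),
    (∀ Q : MvPolynomial (Fin n) ℂ, Integrable (fun x => evalC Q x) μ) ∧
    (∀ Q : MvPolynomial (Fin n) ℂ, Λ Q = ∫ x, evalC Q x ∂μ)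

noncomputable def vanishingIdealC {n : ℕ} (Z : Set (Fin n → ℝ)) :
    Ideal (MvPolynomial (Fin n) ℂ) where
  carrier := {P | ∀ x ∈ Z, evalC P x = 0}
  add_mem' := by
    intro a b ha hb x hx
    simp only [Set.mem_setOf_eq, evalC, map_add] at *
    rw [ha x hx, hb x hx, add_zero]
  zero_mem' := by
    intro x hx
    simp [evalC]
  smul_mem' := by
    intro c a ha x hx
    simp only [Set.mem_setOf_eq, evalC, smul_eq_mul, map_mul] at *
    rw [ha x hx, mul_zero]

def zeroSetC {n : ℕ} (I : Ideal (MvPolynomial (Fin n) ℂ)) : Set (Fin n → ℝ) :=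
  {x | ∀ P ∈ I, evalC P x = 0}

def zSetC {n : ℕ} (P : MvPolynomial (Fin n) ℂ) : Set (Fin n → ℝ) :=
  {x | evalC P x = 0}

def VanishesOnC {n : ℕ} (Λ : MvPolynomial (Fin n) ℂ →ₗ[ℂ] ℂ)
    (I : Ideal (MvPolynomial (Fin n) ℂ)) : Prop :=
  ∀ P ∈ I, Λ P = 0

def nSetC {n : ℕ} (Λ : MvPolynomial (Fin n) ℂ →ₗ[ℂ] ℂ) : Set (MvPolynomial (Fin n) ℂ) :=
  {P | Λ (starC P * P) = 0}

def IsTypeAC {n : ℕ} (P : MvPolynomial (Fin n) ℂ) : Prop :=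
  ∀ Λ : MvPolynomial (Fin n) ℂ →ₗ[ℂ] ℂ,
    IsPosDefC Λ → VanishesOnC Λ (Ideal.span {P}) → IsMomentC Λ

open Polynomial in
/-- The intermediate value property for sign changes of polynomials. Among ordered fields it
characterizes the real closed ones. -/
def PolynomialIVT (L : Type*) [Field L] [LinearOrder L] : Prop :=
  ∀ (p : L[X]) (a b : L), a < b → p.eval a * p.eval b < 0 → ∃ c, a < c ∧ c < b ∧ p.eval c = 0

section RealClosure

open Polynomial

theorem IsSumSq.map_ringHom {R S : Type*} [Semiring R] [Semiring S] (f : R →+* S) {s : R}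
    (hs : IsSumSq s) : IsSumSq (f s) := by
  induction hs with
  | zero => simp
  | sq_add a _ ih => simpa using IsSumSq.sq_add (f a) ih

theorem IsSemireal.of_ringHom {R S : Type*} [Semiring R] [Semiring S] [IsSemireal S]
    (f : R →+* S) : IsSemireal R where
  one_add_ne_zero hs h :=
    IsSemireal.one_add_ne_zero (hs.map_ringHom f) (by rw [← map_one f, ← map_add, h, map_zero])

/-- The cone of sums of squares of polynomials of degree smaller than that of `G`. -/
noncomputable def reducedSumSq {F : Type*} [Field F] (G : F[X]) : AddSubmonoid F[X] :=
  AddSubmonoid.closure ((fun g => g * g) '' {g | g.degree < G.degree})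

/-- Every proper simple algebraic extension of `F` has `-1` as a sum of squares. -/
def HasNoSemirealExtension (F : Type*) [Field F] : Prop :=
  ∀ G : F[X], Irreducible G → 2 ≤ G.natDegree → ∃ S ∈ reducedSumSq G, G ∣ 1 + S

theorem exists_reducedSumSq_of_not_isSemireal_adjoin {F Ω : Type*} [Field F] [Field Ω]
    [Algebra F Ω] (θ : Ω) {G : F[X]} (hG : Irreducible G) (hθ : aeval θ G = 0)
    (h : ¬ IsSemireal (IntermediateField.adjoin F {θ})) : ∃ S ∈ reducedSumSq G, G ∣ 1 + S := by
  have halg : IsAlgebraic F θ := ⟨G, hG.ne_zero, hθ⟩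
  have rep : ∀ z : IntermediateField.adjoin F {θ},
      ∃ g : F[X], g.degree < G.degree ∧ aeval θ g = (z : Ω) := by
    intro z
    have hz : (z : Ω) ∈ (IntermediateField.adjoin F {θ}).toSubalgebra := z.2
    rw [IntermediateField.adjoin_simple_toSubalgebra_of_isAlgebraic halg,
      Algebra.adjoin_singleton_eq_range_aeval] at hz
    obtain ⟨g, hg⟩ := hz
    refine ⟨g % G, EuclideanDomain.mod_lt _ hG.ne_zero, ?_⟩
    have := congrArg (aeval θ) (EuclideanDomain.div_add_mod g G)
    simp only [map_add, map_mul, hθ, zero_mul, zero_add] at this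
    rw [this]; exact hg
  have rep' : ∀ s : IntermediateField.adjoin F {θ}, IsSumSq s →
      ∃ S ∈ reducedSumSq G, aeval θ S = (s : Ω) := by
    intro s hs
    induction hs with
    | zero => exact ⟨0, zero_mem _, by simp⟩
    | sq_add a _ ih =>
      obtain ⟨S, hS, hS'⟩ := ih
      obtain ⟨g, hg, hg'⟩ := rep a
      exact ⟨g * g + S, add_mem (AddSubmonoid.subset_closure ⟨g, hg, rfl⟩) hS, by
        simp [hg', hS']⟩
  have : ∃ s : IntermediateField.adjoin F {θ}, IsSumSq s ∧ 1 + s = 0 := by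
    by_contra! hc
    exact h ⟨fun hs => hc _ hs⟩
  obtain ⟨s, hs, hs0⟩ := this
  obtain ⟨S, hS, hS'⟩ := rep' s hs
  refine ⟨S, hS, ?_⟩
  have h0 : aeval θ (1 + S) = 0 := by
    have := congrArg (Subtype.val) hs0
    simpa [hS'] using this
  have := minpoly.dvd F θ h0
  rw [← minpoly.eq_of_irreducible hG hθ] at this
  exact (dvd_mul_right _ _).trans this

theorem exists_hasNoSemirealExtension (K : Type*) [Field K] [IsSemireal K] :
    ∃ M : IntermediateField K (AlgebraicClosure K), IsSemireal M ∧ HasNoSemirealExtension M := by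
  obtain ⟨M, -, hM⟩ := zorn_le_nonempty₀
    {M : IntermediateField K (AlgebraicClosure K) | IsSemireal M} (by
      intro c hc hchain M₀ hM₀
      refine ⟨sSup c, ?_, fun z hz => le_sSup hz⟩
      have : Nonempty c := ⟨⟨M₀, hM₀⟩⟩
      have hcoe : ((sSup c : IntermediateField K (AlgebraicClosure K)) : Set (AlgebraicClosure K)) =
          ⋃ i : c, ((i : IntermediateField K (AlgebraicClosure K)) : Set _) := by
        rw [sSup_eq_iSup', IntermediateField.coe_iSup_of_directed]
        exact hchain.directed
      have key : ∀ s : (sSup c : IntermediateField K (AlgebraicClosure K)), IsSumSq s →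
          ∃ N ∈ c, ∃ t : N, IsSumSq t ∧ (t : AlgebraicClosure K) = s := by
        intro s hs
        induction hs with
        | zero => exact ⟨M₀, hM₀, 0, IsSumSq.zero, rfl⟩
        | sq_add a _ ih =>
          obtain ⟨N, hN, t, ht, hts⟩ := ih
          have ha : (a : AlgebraicClosure K) ∈ ⋃ i : c,
            ((i : IntermediateField K (AlgebraicClosure K)) : Set _) := hcoe ▸ a.2
          obtain ⟨⟨N', hN'⟩, ha⟩ := Set.mem_iUnion.1 ha
          rcases hchain.total hN hN' with h | h
          · refine ⟨N', hN', ⟨a, ha⟩ * ⟨a, ha⟩ + IntermediateField.inclusion h t,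
              IsSumSq.sq_add _ (ht.map_ringHom (IntermediateField.inclusion h).toRingHom), ?_⟩
            simp [hts]
          · refine ⟨N, hN, ⟨a, h ha⟩ * ⟨a, h ha⟩ + t, IsSumSq.sq_add _ ht, ?_⟩
            simp [hts]
      refine ⟨fun {s} hs h0 => ?_⟩
      obtain ⟨N, hN, t, ht, hts⟩ := key s hs
      have := hc hN
      refine this.one_add_ne_zero ht (Subtype.ext ?_)
      simpa [hts] using congrArg Subtype.val h0) ⊥
    (IsSemireal.of_ringHom
      (IntermediateField.botEquiv K (AlgebraicClosure K) : _ →ₐ[K] K).toRingHom)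
  refine ⟨M, hM.prop, fun G hG hdeg => ?_⟩
  obtain ⟨θ, hθ⟩ := IsAlgClosed.exists_aeval_eq_zero (AlgebraicClosure K) G
    (by rw [degree_eq_natDegree hG.ne_zero]; norm_cast; omega)
  refine exists_reducedSumSq_of_not_isSemireal_adjoin θ hG hθ fun hs => ?_
  have hle : M ≤ (IntermediateField.adjoin M {θ}).restrictScalars K := by
    intro x hx
    exact (IntermediateField.adjoin M {θ}).algebraMap_mem ⟨x, hx⟩
  have hmem : θ ∈ M := (hM.le_of_ge (y := (IntermediateField.adjoin M {θ}).restrictScalars K)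
    hs hle) (IntermediateField.mem_adjoin_simple_self M θ)
  have hroot : G.IsRoot ⟨θ, hmem⟩ := by
    refine Subtype.ext ?_
    have : aeval (algebraMap M (AlgebraicClosure K) ⟨θ, hmem⟩) G = 0 := hθ
    rw [aeval_algebraMap_apply] at this
    simpa [coe_aeval_eq_eval] using this
  have := degree_eq_one_of_irreducible_of_root hG hroot
  rw [degree_eq_natDegree hG.ne_zero] at this
  norm_cast at this
  omega

theorem IsSumSq.div_of_ne_zero {F : Type*} [Field F] {p q : F} (hp : IsSumSq p) (hq : IsSumSq q)
    : IsSumSq (p / q) := by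
  have : p / q = p * q * (q⁻¹ * q⁻¹) := by
    rcases eq_or_ne q 0 with rfl | h
    · simp
    · field_simp
  rw [this]
  exact (hp.mul hq).mul (IsSumSq.mul_self _)

theorem HasNoSemirealExtension.isSumSq_or_neg {F : Type*} [Field F] [IsSemireal F]
    (hF : HasNoSemirealExtension F) (a : F) : IsSumSq a ∨ IsSumSq (-a) := by
  by_cases ha : IsSquare a
  · exact .inl ha.isSumSq
  right
  have hdeg : (X ^ 2 - C a : F[X]).natDegree = 2 := natDegree_X_pow_sub_C
  have hG : Irreducible (X ^ 2 - C a : F[X]) := by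
    refine (Polynomial.irreducible_iff_roots_eq_zero_of_degree_le_three (by omega) (by omega)).2 ?_
    refine Multiset.eq_zero_of_forall_notMem fun r hr => ha ?_
    have := (mem_roots'.1 hr).2
    simp only [IsRoot, eval_sub, eval_pow, eval_X, eval_C, sub_eq_zero] at this
    exact ⟨r, by rw [← this, sq]⟩
  obtain ⟨S, hS, hdvd⟩ := hF _ hG hdeg.ge
  have key : ∃ p q r : F, IsSumSq p ∧ IsSumSq q ∧
      (X ^ 2 - C a : F[X]) ∣ S - (C (p + a * q) + C r * X) := by
    clear hdvd
    induction hS using AddSubmonoid.closure_induction with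
    | mem x hx =>
      obtain ⟨g, hg, rfl⟩ := hx
      have hg1 : g.degree ≤ 1 := by
        have h2 : (X ^ 2 - C a : F[X]).degree = 2 := degree_X_pow_sub_C (by norm_num) a
        rw [Set.mem_ofPred_eq, h2] at hg
        exact Order.le_of_lt_succ hg
      refine ⟨g.coeff 0 * g.coeff 0, g.coeff 1 * g.coeff 1, 2 * g.coeff 0 * g.coeff 1,
        IsSumSq.mul_self _, IsSumSq.mul_self _, C (g.coeff 1 * g.coeff 1), ?_⟩
      have := eq_X_add_C_of_degree_le_one hg1
      generalize g.coeff 0 = u at *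
      generalize g.coeff 1 = v at *
      subst this
      simp only [C_add, C_mul, map_ofNat]
      ring
    | zero => exact ⟨0, 0, 0, .zero, .zero, by simp⟩
    | add x y _ _ hx hy =>
      obtain ⟨p, q, r, hp, hq, h⟩ := hx
      obtain ⟨p', q', r', hp', hq', h'⟩ := hy
      refine ⟨p + p', q + q', r + r', hp.add hp', hq.add hq', ?_⟩
      convert dvd_add h h' using 1
      simp only [C_add, C_mul]
      ring
  obtain ⟨p, q, r, hp, hq, h⟩ := key
  have h1 : (X ^ 2 - C a : F[X]) ∣ C r * X + C (1 + p + a * q) := by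
    convert dvd_sub hdvd h using 1
    simp only [C_add, C_mul, C_1]
    ring
  have h2 := eq_zero_of_dvd_of_natDegree_lt h1
    (by rw [hdeg]; exact lt_of_le_of_lt natDegree_linear_le (by norm_num))
  have h3 : 1 + p + a * q = 0 := by simpa using congrArg (fun f => coeff f 0) h2
  have hq0 : q ≠ 0 := by
    rintro rfl
    exact IsSemireal.one_add_ne_zero hp (by simpa using h3)
  have : -a = (1 + p) / q := by
    field_simp
    linear_combination -h3
  rw [this]
  exact (IsSumSq.one.add hp).div_of_ne_zero hq

theorem HasNoSemirealExtension.polynomialIVT {F : Type*} [Field F] [LinearOrder F]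
    [IsStrictOrderedRing F] (hF : HasNoSemirealExtension F) : PolynomialIVT F := by
  intro p
  induction hn : p.natDegree using Nat.strong_induction_on generalizing p with
  | _ n ih =>
  intro a b hab hp
  have hp0 : p ≠ 0 := by rintro rfl; simp at hp
  have hunit : ¬ IsUnit p := by
    intro hu
    obtain ⟨c, -, rfl⟩ := Polynomial.isUnit_iff.1 hu
    simp only [eval_C] at hp
    exact absurd hp (not_lt.2 (mul_self_nonneg c))
  by_cases hirr : Irreducible p
  · rcases lt_or_ge p.natDegree 2 with hlt | hge
    · have h1 : p.natDegree = 1 := by have := hirr.natDegree_pos; omega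
      obtain ⟨u, v, rfl⟩ := exists_eq_X_add_C_of_natDegree_le_one h1.le
      have hu : u ≠ 0 := by rintro rfl; simp at h1
      refine ⟨-v / u, ?_⟩
      simp only [eval_add, eval_mul, eval_C, eval_X] at hp ⊢
      have e : (u * a + v) * (u * b + v) = (u * u) * ((a - (-v / u)) * (b - (-v / u))) := by
        field_simp
        ring
      rw [e] at hp
      have h' : (a - (-v / u)) * (b - (-v / u)) < 0 :=
        (pos_iff_neg_of_mul_neg hp).1 (mul_self_pos.2 hu)
      rcases mul_neg_iff.1 h' with ⟨h1, h2⟩ | ⟨h1, h2⟩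
      · linarith
      · exact ⟨by linarith, by linarith, by field_simp; ring⟩
    · obtain ⟨S, hS, h, hh⟩ := hF p hirr hge
      have hpos : ∀ x, 0 ≤ S.eval x := by
        intro x
        clear hh
        induction hS using AddSubmonoid.closure_induction with
        | mem y hy => obtain ⟨g, -, rfl⟩ := hy; simpa using mul_self_nonneg (g.eval x)
        | zero => simp
        | add y z _ _ hy hz => simpa using add_nonneg hy hz
      have hdegS : S.natDegree ≤ 2 * (n - 1) := by
        clear hh hpos
        induction hS using AddSubmonoid.closure_induction with
        | mem y hy =>
          obtain ⟨g, hg, rfl⟩ := hy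
          have : g.natDegree ≤ n - 1 := by
            rcases eq_or_ne g 0 with rfl | h0
            · simp
            · have := natDegree_lt_natDegree h0 hg
              omega
          exact natDegree_mul_le.trans (by omega)
        | zero => simp
        | add y z _ _ hy hz => exact natDegree_add_le_of_degree_le hy hz
      have hev : ∀ x, 0 < p.eval x * h.eval x := by
        intro x
        have := congrArg (eval x) hh
        simp only [eval_add, eval_one, eval_mul] at this
        have := hpos x
        linarith
      have hh0 : h ≠ 0 := by rintro rfl; simpa using hev 0
      have hdegh : h.natDegree < n := by
        have h1 := congrArg natDegree hh
        rw [natDegree_mul hp0 hh0] at h1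
        have h2 : (1 + S).natDegree ≤ 2 * (n - 1) :=
          natDegree_add_le_of_degree_le (by simp) hdegS
        omega
      have hsign : h.eval a * h.eval b < 0 := by
        have h1 := mul_pos (hev a) (hev b)
        have e : p.eval a * h.eval a * (p.eval b * h.eval b) =
          (p.eval a * p.eval b) * (h.eval a * h.eval b) := by ring
        rw [e] at h1
        exact (neg_iff_neg_of_mul_pos h1).1 hp
      obtain ⟨c, -, -, hc⟩ := ih _ hdegh h rfl a b hab hsign
      simpa [hc] using hev c
  · have : ∃ f g : F[X], ¬ IsUnit f ∧ ¬ IsUnit g ∧ p = f * g := by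
      by_contra! hcon
      refine hirr ⟨hunit, fun f g hfg => ?_⟩
      by_contra! hc
      exact hcon f g hc.1 hc.2 hfg
    obtain ⟨f, g, hf, hg, rfl⟩ := this
    have hf0 := left_ne_zero_of_mul hp0
    have hg0 := right_ne_zero_of_mul hp0
    have hdf : 0 < f.natDegree :=
      natDegree_pos_iff_degree_pos.2 (degree_pos_of_ne_zero_of_nonunit hf0 hf)
    have hdg : 0 < g.natDegree :=
      natDegree_pos_iff_degree_pos.2 (degree_pos_of_ne_zero_of_nonunit hg0 hg)
    rw [natDegree_mul hf0 hg0] at hn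
    simp only [eval_mul] at hp ⊢
    have e : f.eval a * g.eval a * (f.eval b * g.eval b) =
      (f.eval a * f.eval b) * (g.eval a * g.eval b) := by ring
    rw [e] at hp
    rcases mul_neg_iff.1 hp with ⟨-, h⟩ | ⟨h, -⟩
    · obtain ⟨c, h1, h2, h3⟩ := ih _ (by omega) g rfl a b hab h
      exact ⟨c, h1, h2, by simp [h3]⟩
    · obtain ⟨c, h1, h2, h3⟩ := ih _ (by omega) f rfl a b hab h
      exact ⟨c, h1, h2, by simp [h3]⟩

/-- The cone of sums of squares in a semireal field. -/
def sumSqCone (F : Type*) [Field F] [IsSemireal F] : RingCone F where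
  toSubsemiring := Subsemiring.sumSq F
  eq_zero_of_mem_of_neg_mem' {a} h1 h2 := by
    by_contra h0
    have h1 : IsSumSq a := by simpa using h1
    have h2 : IsSumSq (-a) := by simpa using h2
    refine IsSemireal.one_add_ne_zero (h2.div_of_ne_zero h1) ?_
    field_simp
    ring

/-- Every semireal field embeds into an ordered field with the intermediate value property. -/
theorem exists_ringHom_polynomialIVT.{u} (K : Type u) [Field K] [IsSemireal K] :
    ∃ (L : Type u) (_ : Field L) (_ : LinearOrder L) (_ : IsStrictOrderedRing L) (_ : K →+* L),
      PolynomialIVT L := by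
  classical
  obtain ⟨M, hM, hM'⟩ := exists_hasNoSemirealExtension K
  have hmem : HasMemOrNegMem (sumSqCone M) := ⟨fun a => by
    have := hM'.isSumSq_or_neg a
    simpa [sumSqCone] using this⟩
  let _ : LinearOrder M := LinearOrder.mkOfAddGroupCone (sumSqCone M)
  have _ : IsOrderedRing M := IsOrderedRing.mkOfCone (sumSqCone M)
  have _ : IsStrictOrderedRing M := IsOrderedRing.toIsStrictOrderedRing M
  exact ⟨M, inferInstance, inferInstance, inferInstance, algebraMap K M, hM'.polynomialIVT⟩

end RealClosure

section RootLocation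

open Polynomial

variable {L : Type*} [Field L] [LinearOrder L] [IsStrictOrderedRing L]

theorem PolynomialIVT.exists_derivative_eq_zero (hL : PolynomialIVT L) (p : L[X]) {a b : L}
    (hab : a < b) (ha : p.eval a = 0) (hb : p.eval b = 0) :
    ∃ c, a ≤ c ∧ c ≤ b ∧ p.derivative.eval c = 0 := by
  rcases eq_or_ne p 0 with rfl | hp
  · exact ⟨a, le_rfl, hab.le, by simp⟩
  induction hn : (p.roots.toFinset.filter fun z => z ≤ b).card using Nat.strong_induction_on
    generalizing b with
  | _ n ih =>
  obtain ⟨q, rfl⟩ := dvd_iff_isRoot.2 ha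
  have hq : q.eval b = 0 := by
    simpa [(sub_pos.2 hab).ne'] using hb
  obtain ⟨r, rfl⟩ := dvd_iff_isRoot.2 hq
  by_cases hc : ∃ c, a < c ∧ c < b ∧ r.eval c = 0
  · obtain ⟨c, hac, hcb, hc⟩ := hc
    obtain ⟨d, h1, h2, h3⟩ := ih _ (by
      rw [← hn]
      refine Finset.card_lt_card ⟨fun z hz => ?_, fun hss => ?_⟩
      · rw [Finset.mem_filter] at hz ⊢
        exact ⟨hz.1, hz.2.trans hcb.le⟩
      · have hbm := hss (Finset.mem_filter.2
          ⟨Multiset.mem_toFinset.2 ((mem_roots hp).2 hb), le_refl b⟩)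
        exact absurd (Finset.mem_filter.1 hbm).2 (not_le.2 hcb)) hac (by simp [hc]) rfl
    exact ⟨d, h1, h2.trans hcb.le, h3⟩
  · have hr : 0 ≤ r.eval a * r.eval b := by
      by_contra! h
      exact hc (hL r a b hab h)
    by_cases ha' : r.eval a = 0
    · exact ⟨a, le_rfl, hab.le, by simp [ha']⟩
    by_cases hb' : r.eval b = 0
    · exact ⟨b, hab.le, le_rfl, by simp [hb']⟩
    have hr' : 0 < r.eval a * r.eval b := lt_of_le_of_ne hr (mul_ne_zero ha' hb').symm
    obtain ⟨c, h1, h2, h3⟩ := hL (derivative ((X - C a) * ((X - C b) * r))) a b hab (by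
      simp only [derivative_mul, derivative_sub, derivative_X, derivative_C, eval_add, eval_mul,
        eval_sub, eval_X, eval_C, sub_self, sub_zero, one_mul, zero_mul, add_zero]
      have := mul_pos (mul_pos (sub_pos.2 hab) (sub_pos.2 hab)) hr'
      linarith)
    exact ⟨c, h1.le, h2.le, h3⟩

theorem PolynomialIVT.eval_mul_eval_neg (hL : PolynomialIVT L) (p : L[X]) {a b x : L}
    (hax : a < x) (hxb : x < b) (hx : p.eval x = 0)
    (hp' : ∀ c, a < c → c < b → p.derivative.eval c ≠ 0) (ha : p.eval a ≠ 0) (hb : p.eval b ≠ 0) :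
    p.eval a * p.eval b < 0 := by
  obtain ⟨q, rfl⟩ := dvd_iff_isRoot.2 hx
  have hqab : 0 < q.eval a * q.eval b := by
    by_contra! h
    have h0 : q.eval a * q.eval b ≠ 0 := by
      simp only [eval_mul] at ha hb
      exact mul_ne_zero (right_ne_zero_of_mul ha) (right_ne_zero_of_mul hb)
    obtain ⟨z, haz, hzb, hz⟩ := hL q a b (hax.trans hxb) (lt_of_le_of_ne h h0)
    have hz0 : ((X - C x) * q).eval z = 0 := by simp [hz]
    rcases lt_trichotomy z x with h | rfl | h
    · obtain ⟨c, h1, h2, h3⟩ := hL.exists_derivative_eq_zero _ h hz0 hx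
      exact hp' c (haz.trans_le h1) (h2.trans_lt hxb) h3
    · exact hp' z haz hzb (by simp [hz])
    · obtain ⟨c, h1, h2, h3⟩ := hL.exists_derivative_eq_zero _ h hx hz0
      exact hp' c (hax.trans_le h1) (h2.trans_lt hzb) h3
  simp only [eval_mul, eval_sub, eval_X, eval_C]
  have := mul_pos (mul_pos (sub_pos.2 hax) (sub_pos.2 hxb)) hqab
  linarith

theorem PolynomialIVT.sign_eval_eq (hL : PolynomialIVT L) (p : L[X]) (hp : ∀ x, p.eval x ≠ 0)
    (a b : L) : SignType.sign (p.eval a) = SignType.sign (p.eval b) := by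
  have key : ∀ a b : L, a < b → SignType.sign (p.eval a) = SignType.sign (p.eval b) := by
    intro a b hab
    have h : ¬ p.eval a * p.eval b < 0 := fun h => by
      obtain ⟨c, -, -, hc⟩ := hL p a b hab h
      exact hp c hc
    rcases (hp a).lt_or_gt with h1 | h1 <;> rcases (hp b).lt_or_gt with h2 | h2
    · rw [sign_neg h1, sign_neg h2]
    · exact absurd (mul_neg_of_neg_of_pos h1 h2) h
    · exact absurd (mul_neg_of_pos_of_neg h1 h2) h
    · rw [sign_pos h1, sign_pos h2]
  rcases lt_trichotomy a b with h | rfl | h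
  exacts [key a b h, rfl, (key b a h).symm]

theorem Polynomial.Monic.abs_lt_of_eval_eq_zero {p : L[X]} (hp : p.Monic) {x : L}
    (hx : p.eval x = 0) : |x| < 2 + ∑ i ∈ Finset.range p.natDegree, (p.coeff i ^ 2 + 1) := by
  have hS : ∀ i, |p.coeff i| ≤ p.coeff i ^ 2 + 1 := fun i => by
    rw [← sq_abs]
    nlinarith [sq_nonneg (|p.coeff i| - 1), abs_nonneg (p.coeff i)]
  have hS0 : 0 ≤ ∑ i ∈ Finset.range p.natDegree, (p.coeff i ^ 2 + 1) :=
    Finset.sum_nonneg fun i _ => by positivity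
  rcases le_or_gt |x| 1 with h | h
  · linarith
  refine lt_of_le_of_lt ?_ (lt_add_of_pos_left _ two_pos)
  have hn : p.natDegree ≠ 0 := by
    intro h0
    rw [eq_one_of_monic_natDegree_zero hp h0] at hx
    simp at hx
  obtain ⟨m, hm⟩ := Nat.exists_eq_succ_of_ne_zero hn
  rw [eval_eq_sum_range, Finset.sum_range_succ, hp.coeff_natDegree, one_mul] at hx
  have h1 : |x| ^ p.natDegree ≤
      (∑ i ∈ Finset.range p.natDegree, (p.coeff i ^ 2 + 1)) * |x| ^ m := by
    rw [← abs_pow, eq_neg_of_add_eq_zero_right hx, abs_neg, Finset.sum_mul]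
    refine (Finset.abs_sum_le_sum_abs _ _).trans (Finset.sum_le_sum fun i hi => ?_)
    rw [abs_mul, abs_pow]
    have : i ≤ m := by have := Finset.mem_range.1 hi; omega
    exact mul_le_mul (hS i) (pow_le_pow_right₀ h.le this) (by positivity) (by positivity)
  have hpos : 0 < |x| ^ m := by positivity
  generalize ∑ i ∈ Finset.range p.natDegree, (p.coeff i ^ 2 + 1) = S at *
  rw [hm, pow_succ, mul_comm] at h1
  exact le_of_mul_le_mul_right h1 hpos

end RootLocation

section CommonSubfield

open Polynomial SignType

variable {L₁ L₂ : Type*} [Field L₁] [LinearOrder L₁] [Field L₂] [LinearOrder L₂]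
  {G : Type*} [Field G] {f₁ : G →+* L₁} {f₂ : G →+* L₂}

/-- The pair of embeddings `f₁`, `f₂` of `G` into ordered fields cannot be extended. -/
def IsMaximalPair (f₁ : G →+* L₁) (f₂ : G →+* L₂) : Prop :=
  ∀ x y, (∀ g : G[X], sign (eval₂ f₁ x g) = sign (eval₂ f₂ y g)) → ∃ z, f₁ z = x ∧ f₂ z = y

theorem IsMaximalPair.symm (h : IsMaximalPair f₁ f₂) : IsMaximalPair f₂ f₁ := fun x y hxy =>
  let ⟨z, h1, h2⟩ := h y x fun g => (hxy g).symm
  ⟨z, h2, h1⟩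

variable [IsStrictOrderedRing L₁] [IsStrictOrderedRing L₂]

theorem lt_iff_of_sign_eq (hs : ∀ z, sign (f₁ z) = sign (f₂ z)) {z w : G} :
    f₁ z < f₁ w ↔ f₂ z < f₂ w := by
  rw [← sub_pos, ← sub_pos (a := f₂ w), ← map_sub, ← map_sub, ← sign_eq_one_iff, hs,
    sign_eq_one_iff]

theorem le_iff_of_sign_eq (hs : ∀ z, sign (f₁ z) = sign (f₂ z)) {z w : G} :
    f₁ z ≤ f₁ w ↔ f₂ z ≤ f₂ w := by
  rw [← not_lt, ← not_lt, lt_iff_of_sign_eq hs]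

/-- If all roots of `g` in two real closed fields come from the common subfield, then the sign of
`g` at a point only depends on the position of the point relative to these roots. -/
theorem sign_eval₂_eq_of_sign_sub_eq (h₁ : PolynomialIVT L₁) (h₂ : PolynomialIVT L₂)
    (hs : ∀ z, sign (f₁ z) = sign (f₂ z)) {x : L₁} {y : L₂} (g : G[X])
    (hg₁ : ∀ u, eval₂ f₁ u g = 0 → ∃ z, f₁ z = u) (hg₂ : ∀ u, eval₂ f₂ u g = 0 → ∃ z, f₂ z = u)
    (hxy : ∀ z, g.eval z = 0 → sign (x - f₁ z) = sign (y - f₂ z)) :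
    sign (eval₂ f₁ x g) = sign (eval₂ f₂ y g) := by
  rcases eq_or_ne g 0 with rfl | hg0
  · simp
  induction hn : g.natDegree generalizing g with
  | zero =>
    rw [eq_C_of_natDegree_eq_zero hn]
    simpa using hs _
  | succ n ih =>
    by_cases hroot : ∃ z, g.eval z = 0
    · obtain ⟨z, hz⟩ := hroot
      have hxz := hxy z hz
      obtain ⟨q, rfl⟩ := dvd_iff_isRoot.2 hz
      have hq0 := right_ne_zero_of_mul hg0
      rw [natDegree_mul (X_sub_C_ne_zero z) hq0, natDegree_X_sub_C] at hn
      have := ih q (fun u hu => hg₁ u (by simp [eval₂_mul, hu]))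
        (fun u hu => hg₂ u (by simp [eval₂_mul, hu])) (fun w hw => hxy w (by simp [hw])) hq0
        (by omega)
      rw [eval₂_mul, eval₂_mul, sign_mul, sign_mul, this]
      simp [eval₂_sub, hxz]
    · have key₁ : ∀ u, (g.map f₁).eval u ≠ 0 := by
        intro u hu
        rw [eval_map] at hu
        obtain ⟨z, rfl⟩ := hg₁ u hu
        rw [eval₂_at_apply] at hu
        exact hroot ⟨z, (map_eq_zero f₁).1 hu⟩
      have key₂ : ∀ u, (g.map f₂).eval u ≠ 0 := by
        intro u hu
        rw [eval_map] at hu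
        obtain ⟨z, rfl⟩ := hg₂ u hu
        rw [eval₂_at_apply] at hu
        exact hroot ⟨z, (map_eq_zero f₂).1 hu⟩
      rw [← eval_map, ← eval_map, h₁.sign_eval_eq _ key₁ x (f₁ 0),
        h₂.sign_eval_eq _ key₂ y (f₂ 0), eval_map, eval_map, eval₂_at_apply, eval₂_at_apply, hs]

theorem exists_root_same_cut (h₁ : PolynomialIVT L₁) (h₂ : PolynomialIVT L₂)
    (hs : ∀ z, sign (f₁ z) = sign (f₂ z)) {p : G[X]} (hp : p.Monic) (hp0 : ∀ z, p.eval z ≠ 0)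
    (hp' : ∀ u, eval₂ f₁ u (derivative p) = 0 → ∃ z, f₁ z = u) (hp'0 : derivative p ≠ 0)
    {x : L₁} (hx : eval₂ f₁ x p = 0) (hxG : ∀ z, f₁ z ≠ x) :
    ∃ y, eval₂ f₂ y p = 0 ∧ ∀ z, sign (x - f₁ z) = sign (y - f₂ z) := by
  classical
  by_contra! hcon
  choose! w hw using hcon
  set B : G := 2 + ∑ i ∈ Finset.range p.natDegree, (p.coeff i ^ 2 + 1) with hB
  have hxB : |x| < f₁ B := by
    have := (hp.map f₁).abs_lt_of_eval_eq_zero (x := x) (by rw [eval_map, hx])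
    simpa only [hB, hp.natDegree_map, coeff_map, map_add, map_ofNat, map_sum, map_pow,
      map_one] using this
  set W : Finset G :=
    (p.map f₂).roots.toFinset.image w ∪ (derivative p).roots.toFinset ∪ {B, -B} with hW
  have hBW : B ∈ W := by simp [hW]
  have hBW' : -B ∈ W := by simp [hW]
  obtain ⟨a, ha, hamax⟩ := Finset.exists_max_image (W.filter fun z => f₁ z < x) f₁
    ⟨-B, Finset.mem_filter.2 ⟨hBW', by rw [map_neg]; linarith [(abs_lt.1 hxB).1]⟩⟩
  obtain ⟨b, hb, hbmin⟩ := Finset.exists_min_image (W.filter fun z => x < f₁ z) f₁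
    ⟨B, Finset.mem_filter.2 ⟨hBW, (abs_lt.1 hxB).2⟩⟩
  rw [Finset.mem_filter] at ha hb
  have hcut : ∀ z ∈ W, f₁ z ≤ f₁ a ∨ f₁ b ≤ f₁ z := fun z hz =>
    (hxG z).lt_or_gt.imp (fun h => hamax z (Finset.mem_filter.2 ⟨hz, h⟩))
      fun h => hbmin z (Finset.mem_filter.2 ⟨hz, h⟩)
  have hsign := h₁.eval_mul_eval_neg (p.map f₁) ha.2 hb.2 (by rw [eval_map, hx])
    (fun c hac hcb hc => by
      rw [derivative_map, eval_map] at hc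
      obtain ⟨z, rfl⟩ := hp' c hc
      rw [eval₂_at_apply, map_eq_zero] at hc
      rcases hcut z (by simp [hW, hc, hp'0]) with h | h
      · exact absurd hac (not_lt.2 h)
      · exact absurd hcb (not_lt.2 h))
    (by rw [eval_map, eval₂_at_apply]; simpa using hp0 a)
    (by rw [eval_map, eval₂_at_apply]; simpa using hp0 b)
  rw [eval_map, eval_map, eval₂_at_apply, eval₂_at_apply, ← map_mul, ← sign_eq_neg_one_iff, hs,
    sign_eq_neg_one_iff, map_mul, ← eval₂_at_apply, ← eval₂_at_apply, ← eval_map, ← eval_map]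
    at hsign
  obtain ⟨y, hay, hyb, hy⟩ := h₂ _ _ _ ((lt_iff_of_sign_eq hs).1 (ha.2.trans hb.2)) hsign
  have hyw : w y ∈ W := by
    simp only [hW, Finset.mem_union, Finset.mem_image]
    exact .inl (.inl ⟨y, Multiset.mem_toFinset.2
      ((mem_roots (hp.map f₂).ne_zero).2 hy), rfl⟩)
  rw [eval_map] at hy
  refine hw y hy ?_
  rcases hcut _ hyw with h | h
  · rw [sign_pos (sub_pos.2 (h.trans_lt ha.2)),
      sign_pos (sub_pos.2 (((le_iff_of_sign_eq hs).1 h).trans_lt hay))]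
  · rw [sign_neg (sub_neg.2 (hb.2.trans_le h)),
      sign_neg (sub_neg.2 (hyb.trans_le ((le_iff_of_sign_eq hs).1 h)))]

theorem IsMaximalPair.exists_eq_of_root_of_lt (hmax : IsMaximalPair f₁ f₂) (h₁ : PolynomialIVT L₁)
    (h₂ : PolynomialIVT L₂) (hs : ∀ z, sign (f₁ z) = sign (f₂ z)) {p : G[X]} (hp : p ≠ 0)
    (ih₁ : ∀ g : G[X], g ≠ 0 → g.natDegree < p.natDegree →
      ∀ u, eval₂ f₁ u g = 0 → ∃ z, f₁ z = u)
    (ih₂ : ∀ g : G[X], g ≠ 0 → g.natDegree < p.natDegree →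
      ∀ u, eval₂ f₂ u g = 0 → ∃ z, f₂ z = u)
    {x : L₁} (hx : eval₂ f₁ x p = 0) : ∃ z, f₁ z = x := by
  wlog hmonic : p.Monic generalizing p
  · have hc : p.leadingCoeff⁻¹ ≠ 0 := inv_ne_zero (leadingCoeff_ne_zero.2 hp)
    have hdeg : (p * C p.leadingCoeff⁻¹).natDegree = p.natDegree := natDegree_mul_C hc
    exact this (p := p * C p.leadingCoeff⁻¹) (mul_ne_zero hp (by simpa using hc))
      (by rwa [hdeg]) (by rwa [hdeg]) (by simp [eval₂_mul, hx]) (monic_mul_leadingCoeff_inv hp)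
  by_contra! hxG
  have hp0 : ∀ z, p.eval z ≠ 0 := by
    intro z hz
    obtain ⟨q, rfl⟩ := dvd_iff_isRoot.2 hz
    have hq0 := right_ne_zero_of_mul hp
    obtain ⟨w, hw⟩ := ih₁ q hq0
      (by rw [natDegree_mul (X_sub_C_ne_zero z) hq0, natDegree_X_sub_C]; omega) x (by
        simpa [eval₂_mul, eval₂_sub, sub_eq_zero, (hxG z).symm] using hx)
    exact hxG w hw
  have hdeg : 0 < p.natDegree := by
    refine Nat.pos_of_ne_zero fun h0 => ?_
    rw [eq_one_of_monic_natDegree_zero hmonic h0] at hx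
    simp at hx
  have : CharZero G := (RingHom.charZero_iff f₁.injective).2 inferInstance
  have hp'0 : derivative p ≠ 0 := fun h => hdeg.ne' (derivative_eq_zero.1 h)
  obtain ⟨y, hy, hxy⟩ := exists_root_same_cut h₁ h₂ hs hmonic hp0
    (ih₁ _ hp'0 (natDegree_derivative_lt hdeg.ne')) hp'0 hx hxG
  obtain ⟨z, hz, -⟩ := hmax x y fun g => by
    have e₁ : eval₂ f₁ x g = eval₂ f₁ x (g %ₘ p) := by
      conv_lhs => rw [← modByMonic_add_div g p, eval₂_add, eval₂_mul, hx]
      simp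
    have e₂ : eval₂ f₂ y g = eval₂ f₂ y (g %ₘ p) := by
      conv_lhs => rw [← modByMonic_add_div g p, eval₂_add, eval₂_mul, hy]
      simp
    rw [e₁, e₂]
    rcases eq_or_ne (g %ₘ p) 0 with h0 | h0
    · simp [h0]
    have hlt : (g %ₘ p).natDegree < p.natDegree :=
      natDegree_lt_natDegree h0 (degree_modByMonic_lt g hmonic)
    exact sign_eval₂_eq_of_sign_sub_eq h₁ h₂ hs _ (ih₁ _ h0 hlt) (ih₂ _ h0 hlt)
      fun z _ => hxy z
  exact hxG z hz

theorem IsMaximalPair.exists_eq_of_root (hmax : IsMaximalPair f₁ f₂) (h₁ : PolynomialIVT L₁)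
    (h₂ : PolynomialIVT L₂) (hs : ∀ z, sign (f₁ z) = sign (f₂ z)) {p : G[X]} (hp : p ≠ 0) :
    (∀ u, eval₂ f₁ u p = 0 → ∃ z, f₁ z = u) ∧ (∀ u, eval₂ f₂ u p = 0 → ∃ z, f₂ z = u) := by
  induction hn : p.natDegree using Nat.strong_induction_on generalizing p with
  | _ n ih =>
  subst hn
  have ih₁ := fun (g : G[X]) hg (hlt : g.natDegree < p.natDegree) => (ih _ hlt hg rfl).1
  have ih₂ := fun (g : G[X]) hg (hlt : g.natDegree < p.natDegree) => (ih _ hlt hg rfl).2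
  exact ⟨fun u hu => hmax.exists_eq_of_root_of_lt h₁ h₂ hs hp ih₁ ih₂ hu,
    fun u hu => hmax.symm.exists_eq_of_root_of_lt h₂ h₁ (fun z => (hs z).symm) hp ih₂ ih₁ hu⟩

theorem IsMaximalPair.exists_forall_sign_eq (hmax : IsMaximalPair f₁ f₂) (h₁ : PolynomialIVT L₁)
    (h₂ : PolynomialIVT L₂) (hs : ∀ z, sign (f₁ z) = sign (f₂ z)) (x : L₁) (J : Finset G[X]) :
    ∃ y, ∀ p ∈ J, sign (eval₂ f₁ x p) = sign (eval₂ f₂ y p) := by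
  classical
  by_cases hx : ∃ z, f₁ z = x
  · obtain ⟨z, rfl⟩ := hx
    exact ⟨f₂ z, fun p _ => by simpa [eval₂_at_apply] using hs _⟩
  push Not at hx
  set W : Finset G := J.biUnion fun p => p.roots.toFinset
  obtain ⟨y, hy₁, hy₂⟩ := Order.exists_between_finsets
    ((W.filter fun z => f₁ z < x).image f₂) ((W.filter fun z => x < f₁ z).image f₂) (by
      intro u hu v hv
      obtain ⟨a, ha, rfl⟩ := Finset.mem_image.1 hu
      obtain ⟨b, hb, rfl⟩ := Finset.mem_image.1 hv
      exact (lt_iff_of_sign_eq hs).1 ((Finset.mem_filter.1 ha).2.trans (Finset.mem_filter.1 hb).2))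
  refine ⟨y, fun p hp => ?_⟩
  rcases eq_or_ne p 0 with rfl | hp0
  · simp
  obtain ⟨hp₁, hp₂⟩ := hmax.exists_eq_of_root h₁ h₂ hs hp0
  refine sign_eval₂_eq_of_sign_sub_eq h₁ h₂ hs p hp₁ hp₂ fun z hz => ?_
  have hzW : z ∈ W := Finset.mem_biUnion.2 ⟨p, hp, by simpa [hp0] using hz⟩
  rcases (hx z).lt_or_gt with h | h
  · rw [sign_pos (sub_pos.2 h), sign_pos (sub_pos.2 (hy₁ _ (Finset.mem_image_of_mem _
      (Finset.mem_filter.2 ⟨hzW, h⟩))))]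
  · rw [sign_neg (sub_neg.2 h), sign_neg (sub_neg.2 (hy₂ _ (Finset.mem_image_of_mem _
      (Finset.mem_filter.2 ⟨hzW, h⟩))))]

theorem sign_inv_eq {L : Type*} [Field L] [LinearOrder L] [IsStrictOrderedRing L] (a : L) :
    sign a⁻¹ = sign a := by
  rcases lt_trichotomy a 0 with h | rfl | h
  · rw [sign_neg h, sign_neg (inv_lt_zero.2 h)]
  · simp
  · rw [sign_pos h, sign_pos (inv_pos.2 h)]

theorem exists_isMaximalPair {R : Type*} [CommRing R] (φ₁ : R →+* L₁) (φ₂ : R →+* L₂)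
    (hs : ∀ q, sign (φ₁ q) = sign (φ₂ q)) :
    ∃ (G : Subring (L₁ × L₂)) (_ : Field G) (f₁ : G →+* L₁) (f₂ : G →+* L₂) (ψ : R →+* G),
      f₁.comp ψ = φ₁ ∧ f₂.comp ψ = φ₂ ∧ (∀ z, sign (f₁ z) = sign (f₂ z)) ∧
        IsMaximalPair f₁ f₂ := by
  obtain ⟨G, hG, hmax⟩ := zorn_le_nonempty₀
    {G : Subring (L₁ × L₂) | ∀ z ∈ G, sign z.1 = sign z.2} (by
      intro c hc hchain G₀ hG₀
      refine ⟨sSup c, fun z hz => ?_, fun G hG => le_sSup hG⟩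
      obtain ⟨G, hGc, hzG⟩ :=
        (Subring.mem_sSup_of_directedOn ⟨G₀, hG₀⟩ hchain.directedOn).1 hz
      exact hc hGc z hzG) (φ₁.prod φ₂).range (by
      rintro _ ⟨q, rfl⟩
      exact hs q)
  set f₁ : G →+* L₁ := (RingHom.fst L₁ L₂).comp G.subtype
  set f₂ : G →+* L₂ := (RingHom.snd L₁ L₂).comp G.subtype
  have hsG : ∀ z, sign (f₁ z) = sign (f₂ z) := fun z => hmax.prop z.1 z.2
  have hadj : ∀ x y, (∀ g : G[X], sign (eval₂ f₁ x g) = sign (eval₂ f₂ y g)) →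
      ∃ z, f₁ z = x ∧ f₂ z = y := by
    intro x y hxy
    have hmem : (x, y) ∈ G := hmax.le_of_ge (y := (eval₂RingHom G.subtype (x, y)).range) (by
        rintro _ ⟨g, rfl⟩
        have e₁ := hom_eval₂ g G.subtype (RingHom.fst L₁ L₂) (x, y)
        have e₂ := hom_eval₂ g G.subtype (RingHom.snd L₁ L₂) (x, y)
        simp only [RingHom.coe_fst, RingHom.coe_snd] at e₁ e₂
        rw [coe_eval₂RingHom, e₁, e₂]
        exact hxy g) (fun z hz => ⟨C ⟨z, hz⟩, by simp⟩) ⟨X, by simp⟩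
    exact ⟨⟨(x, y), hmem⟩, rfl, rfl⟩
  have hz₀ : ∀ z, f₁ z = 0 ↔ f₂ z = 0 := fun z => by
    rw [← sign_eq_zero_iff, hsG, sign_eq_zero_iff]
  have hfield : IsField G := by
    refine ⟨⟨0, 1, zero_ne_one⟩, mul_comm, fun {z} hz => ?_⟩
    have hz₁ : f₁ z ≠ 0 := fun h => hz (Subtype.ext (Prod.ext h ((hz₀ z).1 h)))
    have hz₂ : f₂ z ≠ 0 := fun h => hz₁ ((hz₀ z).2 h)
    obtain ⟨w, hw₁, hw₂⟩ := hadj (f₁ z)⁻¹ (f₂ z)⁻¹ fun g => by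
      let _ := invertibleOfNonzero (inv_ne_zero hz₁)
      let _ := invertibleOfNonzero (inv_ne_zero hz₂)
      rw [← eval₂_reverse_mul_pow f₁, ← eval₂_reverse_mul_pow f₂, sign_mul, sign_mul, sign_pow,
        sign_pow, invOf_eq_inv, invOf_eq_inv, inv_inv, inv_inv, eval₂_at_apply, eval₂_at_apply,
        hsG, sign_inv_eq, sign_inv_eq, hsG]
    refine ⟨w, Subtype.ext (Prod.ext ?_ ?_)⟩
    · change f₁ z * f₁ w = 1
      rw [hw₁, mul_inv_cancel₀ hz₁]
    · change f₂ z * f₂ w = 1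
      rw [hw₂, mul_inv_cancel₀ hz₂]
  exact ⟨G, hfield.toField, f₁, f₂,
    (φ₁.prod φ₂).codRestrict G fun q => hG ⟨q, rfl⟩, rfl, rfl, hsG, hadj⟩

/-- Two real closed fields whose orders agree on a subring are elementarily similar: every element
of the first has a counterpart in the second with respect to finitely many polynomials. -/
theorem PolynomialIVT.exists_forall_sign_eq {R : Type*} [CommRing R] (h₁ : PolynomialIVT L₁)
    (h₂ : PolynomialIVT L₂) (φ₁ : R →+* L₁) (φ₂ : R →+* L₂)
    (hs : ∀ q, sign (φ₁ q) = sign (φ₂ q)) (x : L₁) (J : Finset R[X]) :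
    ∃ y, ∀ p ∈ J, sign (eval₂ φ₁ x p) = sign (eval₂ φ₂ y p) := by
  classical
  obtain ⟨G, _, f₁, f₂, ψ, rfl, rfl, hsG, hmax⟩ := exists_isMaximalPair φ₁ φ₂ hs
  obtain ⟨y, hy⟩ := hmax.exists_forall_sign_eq h₁ h₂ hsG x (J.image (Polynomial.map ψ))
  refine ⟨y, fun p hp => ?_⟩
  simpa [eval₂_map] using hy _ (Finset.mem_image_of_mem _ hp)

end CommonSubfield

section Transfer

open Polynomial SignType Filter

theorem Filter.Germ.sign_coe_eq_iff {ι : Type*} (𝓤 : Ultrafilter ι) (g : ι → ℝ) (s : SignType) :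
    sign (Germ.coeRingHom (𝓤 : Filter ι) g) = s ↔ ∀ᶠ i in 𝓤, sign (g i) = s := by
  have hneg : sign (Germ.coeRingHom (𝓤 : Filter ι) g) = -1 ↔ ∀ᶠ i in 𝓤, sign (g i) = -1 := by
    simp only [sign_eq_neg_one_iff]
    exact Germ.coe_lt (g := fun _ => (0 : ℝ))
  have hpos : sign (Germ.coeRingHom (𝓤 : Filter ι) g) = 1 ↔ ∀ᶠ i in 𝓤, sign (g i) = 1 := by
    simp only [sign_eq_one_iff]
    exact Germ.coe_pos
  have hzero : sign (Germ.coeRingHom (𝓤 : Filter ι) g) = 0 ↔ ∀ᶠ i in 𝓤, sign (g i) = 0 := by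
    simp only [sign_eq_zero_iff]
    exact Germ.coe_eq (g := fun _ => (0 : ℝ))
  cases s
  exacts [hzero, hneg, hpos]

theorem polynomialIVT_real : PolynomialIVT ℝ := by
  intro p a b hab h
  rcases mul_neg_iff.1 h with h | h
  · obtain ⟨c, hc, hc0⟩ := intermediate_value_Ioo' hab.le p.continuous.continuousOn ⟨h.2, h.1⟩
    exact ⟨c, hc.1, hc.2, hc0⟩
  · obtain ⟨c, hc, hc0⟩ := intermediate_value_Ioo hab.le p.continuous.continuousOn h
    exact ⟨c, hc.1, hc.2, hc0⟩

theorem polynomialIVT_germ {ι : Type*} (𝓤 : Ultrafilter ι) :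
    PolynomialIVT (Germ (𝓤 : Filter ι) ℝ) := by
  intro p a b hab h
  have hsurj : Function.Surjective (Germ.coeRingHom (R := ℝ) (𝓤 : Filter ι)) := fun z =>
    Quotient.inductionOn' z fun g => ⟨g, rfl⟩
  obtain ⟨q, rfl⟩ := Polynomial.map_surjective _ hsurj p
  obtain ⟨a, rfl⟩ := hsurj a
  obtain ⟨b, rfl⟩ := hsurj b
  have hev : ∀ c, eval (Germ.coeRingHom (𝓤 : Filter ι) c) (q.map (Germ.coeRingHom (𝓤 : Filter ι))) =
      Germ.coeRingHom (𝓤 : Filter ι) fun i => eval (c i) (q.map (Pi.evalRingHom (fun _ => ℝ) i)) := by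
    intro c
    rw [eval_map, eval₂_at_apply]
    congr 1
    ext i
    rw [eval_map]
    exact (eval₂_at_apply (Pi.evalRingHom (fun _ : ι => ℝ) i) c).symm
  rw [hev, hev, ← map_mul] at h
  have hab' : ∀ᶠ i in 𝓤, a i < b i := Germ.coe_lt.1 hab
  have h' := Germ.coe_lt (g := fun _ => (0 : ℝ)).1 h
  have : ∀ i, ∃ c, a i < b i ∧ eval (a i) (q.map (Pi.evalRingHom (fun _ => ℝ) i)) *
      eval (b i) (q.map (Pi.evalRingHom (fun _ => ℝ) i)) < 0 → a i < c ∧ c < b i ∧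
        eval c (q.map (Pi.evalRingHom (fun _ => ℝ) i)) = 0 := by
    intro i
    by_cases hi : a i < b i ∧ eval (a i) (q.map (Pi.evalRingHom (fun _ => ℝ) i)) *
      eval (b i) (q.map (Pi.evalRingHom (fun _ => ℝ) i)) < 0
    · obtain ⟨c, hc⟩ := polynomialIVT_real _ _ _ hi.1 hi.2
      exact ⟨c, fun _ => hc⟩
    · exact ⟨0, fun h => absurd h hi⟩
  choose c hc using this
  refine ⟨Germ.coeRingHom (𝓤 : Filter ι) c, Germ.coe_lt.2 ?_, Germ.coe_lt.2 ?_, ?_⟩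
  · filter_upwards [hab', h'] with i h1 h2 using (hc i ⟨h1, h2⟩).1
  · filter_upwards [hab', h'] with i h1 h2 using (hc i ⟨h1, h2⟩).2.1
  · rw [hev]
    refine Germ.coe_eq (g := fun _ => (0 : ℝ)).2 ?_
    filter_upwards [hab', h'] with i h1 h2 using (hc i ⟨h1, h2⟩).2.2

theorem sign_ringHom_real {L : Type*} [Field L] [LinearOrder L] [IsStrictOrderedRing L]
    (φ : ℝ →+* L) (c : ℝ) : sign (φ c) = sign c := by
  have key : ∀ c : ℝ, 0 < c → 0 < φ c := fun c hc => by
    rw [← Real.mul_self_sqrt hc.le, map_mul]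
    exact mul_self_pos.2 ((map_ne_zero φ).2 (Real.sqrt_ne_zero'.2 hc))
  rcases lt_trichotomy c 0 with h | rfl | h
  · rw [sign_neg h, sign_neg]
    simpa using key (-c) (neg_pos.2 h)
  · simp
  · rw [sign_pos h, sign_pos (key c h)]

theorem MvPolynomial.eval₂_cons {R S : Type*} [CommSemiring R] [CommSemiring S] {d : ℕ}
    (φ : R →+* S) (y : S) (s : Fin d → S) (p : MvPolynomial (Fin (d + 1)) R) :
    MvPolynomial.eval₂ φ (Fin.cons y s : Fin (d + 1) → S) p =
      Polynomial.eval₂ (MvPolynomial.eval₂Hom φ s) y (MvPolynomial.finSuccEquiv R d p) := by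
  have : MvPolynomial.eval₂Hom φ (Fin.cons y s : Fin (d + 1) → S) =
      (Polynomial.eval₂RingHom (MvPolynomial.eval₂Hom φ s) y).comp
        (MvPolynomial.finSuccEquiv R d : _ ≃ₐ[R] _).toRingEquiv.toRingHom := by
    refine MvPolynomial.ringHom_ext (fun c => ?_) (fun i => ?_)
    · have : MvPolynomial.finSuccEquiv R d (MvPolynomial.C c) =
          Polynomial.C (MvPolynomial.C c) := (MvPolynomial.finSuccEquiv R d).commutes c
      simp [this]
    · refine Fin.cases ?_ (fun j => ?_) i
      · simp [MvPolynomial.finSuccEquiv_X_zero]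
      · simp [MvPolynomial.finSuccEquiv_X_succ]
  exact RingHom.congr_fun this p

/-- A weak form of the Tarski transfer principle. -/
theorem PolynomialIVT.exists_real_forall_sign_eq {L : Type*} [Field L] [LinearOrder L]
    [IsStrictOrderedRing L] (hL : PolynomialIVT L) (φ : ℝ →+* L) {d : ℕ} (x : Fin d → L)
    (J : Finset (MvPolynomial (Fin d) ℝ)) : ∃ r : Fin d → ℝ, ∀ p ∈ J,
      sign (MvPolynomial.eval₂ φ x p) = sign (MvPolynomial.eval r p) := by
  classical
  induction d with
  | zero =>
    refine ⟨Fin.elim0, fun p _ => ?_⟩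
    obtain ⟨c, rfl⟩ := MvPolynomial.C_surjective (Fin 0) p
    simpa using sign_ringHom_real φ c
  | succ d ih =>
    choose r hr using ih (Fin.tail x)
    set 𝓤 : Ultrafilter (Finset (MvPolynomial (Fin d) ℝ)) := Ultrafilter.of atTop
    set ρ := Germ.coeRingHom (R := ℝ) (𝓤 : Filter (Finset (MvPolynomial (Fin d) ℝ)))
    set ev : MvPolynomial (Fin d) ℝ →+* (Finset (MvPolynomial (Fin d) ℝ) → ℝ) :=
      RingHom.pi fun J => MvPolynomial.eval (r J)
    obtain ⟨y, hy⟩ := hL.exists_forall_sign_eq (polynomialIVT_germ 𝓤)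
      (MvPolynomial.eval₂Hom φ (Fin.tail x)) (ρ.comp ev) (fun q => by
        refine ((Germ.sign_coe_eq_iff 𝓤 _ _).2 ?_).symm
        refine Ultrafilter.of_le atTop ?_
        filter_upwards [eventually_ge_atTop {q}] with K hK
        exact (hr K q (Finset.singleton_subset_iff.1 hK)).symm) (x 0)
      (J.image (MvPolynomial.finSuccEquiv ℝ d))
    obtain ⟨g, rfl⟩ : ∃ g, ρ g = y := Quotient.inductionOn' y fun g => ⟨g, rfl⟩
    have hev : ∀ᶠ K in 𝓤, ∀ p ∈ J, sign (MvPolynomial.eval (Fin.cons (g K) (r K)) p) =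
        sign (MvPolynomial.eval₂ φ x p) := by
      rw [eventually_all_finset]
      intro p hp
      have h := hy _ (Finset.mem_image_of_mem _ hp)
      rw [← MvPolynomial.eval₂_cons, Fin.cons_self_tail, ← hom_eval₂] at h
      filter_upwards [(Germ.sign_coe_eq_iff 𝓤 _ _).1 h.symm] with K hK
      rw [← hK, MvPolynomial.eval_eq_eval_mv_eval', eval_map]
      congr 1
      exact (hom_eval₂ _ ev (Pi.evalRingHom (fun _ => ℝ) K) g).symm
    obtain ⟨K, hK⟩ := hev.exists
    exact ⟨_, fun p hp => (hK p hp).symm⟩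

end Transfer

section Nullstellensatz

/-- An ideal is real if a sum of squares lies in it only if each of the summed elements does. -/
def Ideal.IsReal {A : Type*} [CommRing A] (J : Ideal A) : Prop :=
  ∀ f s, IsSumSq s → f * f + s ∈ J → f ∈ J

theorem Ideal.IsReal.isRadical {A : Type*} [CommRing A] {J : Ideal A} (hJ : J.IsReal) :
    J.IsRadical := by
  have h2 : ∀ f : A, f ^ 2 ∈ J → f ∈ J := fun f hf =>
    hJ f 0 .zero (by rwa [add_zero, ← sq])
  rw [← Ideal.radical_eq_iff]
  refine le_antisymm ?_ Ideal.le_radical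
  rintro f ⟨k, hk⟩
  induction k using Nat.strong_induction_on with
  | _ k ih =>
  rcases Nat.lt_or_ge k 2 with hlt | hge
  · interval_cases k
    · rw [pow_zero] at hk
      rw [(Ideal.eq_top_iff_one J).2 hk]
      trivial
    · simpa using hk
  · obtain ⟨m, rfl | rfl⟩ := Nat.even_or_odd' k
    · exact ih m (by omega) (h2 _ (by rwa [← pow_mul, mul_comm]))
    · exact ih (m + 1) (by omega) (h2 _ (by
        convert J.mul_mem_left f hk using 1
        ring))

theorem Ideal.exists_notMem_mul_mem_of_mem_minimalPrimes {A : Type*} [CommRing A] {J P : Ideal A}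
    (hJ : J.IsRadical) (hP : P ∈ J.minimalPrimes) {x : A} (hx : x ∈ P) : ∃ g ∉ P, g * x ∈ J := by
  have hPprime : P.IsPrime := hP.1.1
  by_contra! hcon
  obtain ⟨Q, hQ, hJQ, hdisj⟩ := J.exists_le_prime_disjoint (P.primeCompl ⊔ Submonoid.powers x) (by
    rw [Set.disjoint_left]
    intro z hzJ hz
    obtain ⟨g, hg, _, ⟨k, rfl⟩, rfl⟩ := Submonoid.mem_sup.1 hz
    refine hcon g hg (hJ ⟨k + 1, ?_⟩)
    convert J.mul_mem_left (g ^ k * x) hzJ using 1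
    ring)
  rw [Set.disjoint_left] at hdisj
  have hQP : Q ≤ P := fun z hz => by
    by_contra hzP
    exact hdisj hz (Submonoid.mem_sup_left hzP)
  exact hdisj (hP.2 ⟨hQ, hJQ⟩ hQP hx) (Submonoid.mem_sup_right (Submonoid.mem_powers x))

theorem Ideal.IsReal.of_mem_minimalPrimes {A : Type*} [CommRing A] {J P : Ideal A}
    (hJ : J.IsReal) (hP : P ∈ J.minimalPrimes) : P.IsReal := by
  intro f s hs hfs
  have hPprime : P.IsPrime := hP.1.1
  obtain ⟨g, hg, hgJ⟩ := exists_notMem_mul_mem_of_mem_minimalPrimes hJ.isRadical hP hfs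
  have : g * f ∈ J := hJ _ (g * g * s) ((IsSumSq.mul_self g).mul hs) (by
    convert J.mul_mem_left g hgJ using 1
    ring)
  exact (hPprime.mem_or_mem (hP.1.2 this)).resolve_left hg

theorem Ideal.IsReal.isSemireal_fractionRing {A : Type*} [CommRing A] {P : Ideal A} [P.IsPrime]
    (hP : P.IsReal) : IsSemireal (FractionRing (A ⧸ P)) := by
  set π : A →+* FractionRing (A ⧸ P) :=
    (algebraMap (A ⧸ P) (FractionRing (A ⧸ P))).comp (Ideal.Quotient.mk P) with hπ
  have hπ0 : ∀ a, π a = 0 ↔ a ∈ P := fun a => by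
    simp [hπ, Ideal.Quotient.eq_zero_iff_mem]
  have key : ∀ s : FractionRing (A ⧸ P), IsSumSq s →
      ∃ d ∉ P, ∃ t, IsSumSq t ∧ π d * π d * s = π t := by
    intro s hs
    induction hs with
    | zero => exact ⟨1, (Ideal.ne_top_iff_one P).1 Ideal.IsPrime.ne_top', 0, .zero, by simp⟩
    | sq_add a _ ih =>
      obtain ⟨d, hd, t, ht, h⟩ := ih
      obtain ⟨u, v, hv, rfl⟩ := IsFractionRing.div_surjective (A := A ⧸ P) a
      obtain ⟨u, rfl⟩ := Ideal.Quotient.mk_surjective u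
      obtain ⟨v, rfl⟩ := Ideal.Quotient.mk_surjective v
      have hvP : v ∉ P := fun hvP => nonZeroDivisors.ne_zero hv
        (Ideal.Quotient.eq_zero_iff_mem.2 hvP)
      have hv0 : π v ≠ 0 := mt (hπ0 v).1 hvP
      refine ⟨d * v, fun hdv => (Ideal.IsPrime.mem_or_mem ‹_› hdv).elim hd hvP,
        d * u * (d * u) + v * v * t, .sq_add _ ((IsSumSq.mul_self v).mul ht), ?_⟩
      change _ * (π u / π v * (π u / π v) + _) = _
      simp only [map_add, map_mul, ← h]
      field_simp
  refine ⟨fun {s} hs h0 => ?_⟩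
  obtain ⟨d, hd, t, ht, h⟩ := key s hs
  refine hd (hP d t ht ((hπ0 _).1 ?_))
  rw [map_add, map_mul, ← h]
  linear_combination (π d * π d) * h0

/-- The real Nullstellensatz. -/
theorem Ideal.IsReal.mem_of_forall_eval_eq_zero {n : ℕ} {J : Ideal (MvPolynomial (Fin n) ℝ)}
    (hJ : J.IsReal) {h : MvPolynomial (Fin n) ℝ}
    (hh : ∀ r, (∀ p ∈ J, MvPolynomial.eval r p = 0) → MvPolynomial.eval r h = 0) : h ∈ J := by
  classical
  by_contra hhJ
  rw [← hJ.isRadical.radical, ← Ideal.sInf_minimalPrimes, Ideal.mem_sInf] at hhJ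
  push Not at hhJ
  obtain ⟨P, hP, hhP⟩ := hhJ
  have hPprime : P.IsPrime := hP.1.1
  have := (hJ.of_mem_minimalPrimes hP).isSemireal_fractionRing
  obtain ⟨L, _, _, _, ι, hL⟩ :=
    exists_ringHom_polynomialIVT (FractionRing (MvPolynomial (Fin n) ℝ ⧸ P))
  set π : MvPolynomial (Fin n) ℝ →+* L := ι.comp
    ((algebraMap (MvPolynomial (Fin n) ℝ ⧸ P) _).comp (Ideal.Quotient.mk P)) with hπ
  have hπ0 : ∀ a, π a = 0 ↔ a ∈ P := fun a => by
    simp [hπ, Ideal.Quotient.eq_zero_iff_mem]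
  have hev : ∀ p, MvPolynomial.eval₂ (π.comp MvPolynomial.C) (fun i => π (MvPolynomial.X i)) p =
      π p := by
    have : MvPolynomial.eval₂Hom (π.comp MvPolynomial.C) (fun i => π (MvPolynomial.X i)) = π :=
      MvPolynomial.ringHom_ext (by simp) (by simp)
    exact RingHom.congr_fun this
  obtain ⟨S, hS⟩ := IsNoetherian.noetherian J
  obtain ⟨r, hr⟩ := hL.exists_real_forall_sign_eq (π.comp MvPolynomial.C)
    (fun i => π (MvPolynomial.X i)) (insert h S)
  have hr0 : ∀ p ∈ insert h S, MvPolynomial.eval r p = 0 ↔ p ∈ P := fun p hp => by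
    rw [← hπ0, ← sign_eq_zero_iff, ← hr p hp, hev, sign_eq_zero_iff]
  have hSr : J ≤ RingHom.ker (MvPolynomial.eval r) := by
    rw [← hS]
    refine Ideal.span_le.2 fun p hp => ?_
    exact (hr0 p (Finset.mem_insert_of_mem hp)).2 (hP.1.2 (hS ▸ Ideal.subset_span hp))
  exact hhP ((hr0 h (Finset.mem_insert_self _ _)).1 (hh r hSr))

end Nullstellensatz

section PositiveFunctional

open MvPolynomial

variable {n : ℕ}

/-- The inclusion of real polynomials into complex polynomials. -/
noncomputable abbrev complexify : MvPolynomial (Fin n) ℝ →+* MvPolynomial (Fin n) ℂ :=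
  MvPolynomial.map Complex.ofRealHom

theorem starC_complexify (p : MvPolynomial (Fin n) ℝ) : starC (complexify p) = complexify p := by
  have : (starRingEnd ℂ).comp Complex.ofRealHom = Complex.ofRealHom :=
    RingHom.ext fun x => Complex.conj_ofReal x
  rw [starC, map_map, this]

theorem evalC_complexify (p : MvPolynomial (Fin n) ℝ) (x : Fin n → ℝ) :
    evalC (complexify p) x = (eval x p : ℝ) := by
  have : ((aeval fun i => (x i : ℂ)) : MvPolynomial (Fin n) ℂ →ₐ[ℂ] ℂ).toRingHom.comp complexify =
      Complex.ofRealHom.comp (eval x) :=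
    ringHom_ext (by simp) (by simp)
  exact RingHom.congr_fun this p

theorem exists_eq_complexify_add (P : MvPolynomial (Fin n) ℂ) :
    ∃ A B, P = complexify A + C Complex.I * complexify B := by
  induction P using MvPolynomial.induction_on with
  | C a =>
    refine ⟨C a.re, C a.im, ?_⟩
    simp only [map_C, ← C_mul, ← C_add]
    congr 1
    simpa [mul_comm] using (Complex.re_add_im a).symm
  | add P Q hP hQ =>
    obtain ⟨A, B, rfl⟩ := hP
    obtain ⟨A', B', rfl⟩ := hQ
    refine ⟨A + A', B + B', ?_⟩
    simp only [map_add]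
    ring
  | mul_X P i hP =>
    obtain ⟨A, B, rfl⟩ := hP
    refine ⟨A * X i, B * X i, ?_⟩
    simp only [map_mul, map_X]
    ring

theorem exists_complexify_eq_starC_mul_self (P : MvPolynomial (Fin n) ℂ) :
    ∃ h, complexify h = starC P * P ∧
      ∀ x, eval x h = 0 ↔ evalC P x = 0 := by
  obtain ⟨A, B, rfl⟩ := exists_eq_complexify_add P
  refine ⟨A * A + B * B, ?_, fun x => ?_⟩
  · have hI : (C Complex.I * C Complex.I : MvPolynomial (Fin n) ℂ) = -1 := by
      rw [← C_mul, Complex.I_mul_I, C_neg, C_1]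
    have hs : starC (complexify A + C Complex.I * complexify B) =
        complexify A - C Complex.I * complexify B := by
      have hA := starC_complexify A
      have hB := starC_complexify B
      rw [starC] at hA hB ⊢
      rw [map_add, map_mul, hA, hB, map_C, Complex.conj_I, C_neg]
      ring
    rw [hs, map_add, map_mul, map_mul]
    linear_combination (complexify B * complexify B) * hI
  · have : evalC (complexify A + C Complex.I * complexify B) x =
        (eval x A : ℝ) + Complex.I * (eval x B : ℝ) := by
      rw [← evalC_complexify, ← evalC_complexify]
      simp only [evalC, map_add, map_mul, aeval_C, Algebra.algebraMap_self, RingHom.id_apply]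
    rw [this, Complex.ext_iff]
    simp only [map_add, map_mul]
    simpa using mul_self_add_mul_self_eq_zero

variable {Λ : MvPolynomial (Fin n) ℂ →ₗ[ℂ] ℂ}

theorem IsPosDefC.nonneg_of_isSumSq (hΛ : IsPosDefC Λ) {s : MvPolynomial (Fin n) ℝ}
    (hs : IsSumSq s) : 0 ≤ Λ (complexify s) := by
  induction hs with
  | zero => simp
  | sq_add a _ ih =>
    rw [map_add, map_add]
    refine add_nonneg ?_ ih
    have := hΛ (complexify a)
    rwa [starC_complexify, ← map_mul] at this

theorem IsPosDefC.apply_complexify_eq_zero (hΛ : IsPosDefC Λ) {u : MvPolynomial (Fin n) ℝ}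
    (hu : Λ (complexify (u * u)) = 0) : Λ (complexify u) = 0 := by
  have key : ∀ t : ℝ, 0 ≤ Λ 1 + (2 * t : ℝ) * Λ (complexify u) := by
    intro t
    have h := hΛ.nonneg_of_isSumSq (IsSumSq.mul_self (1 + C t * u))
    have e : complexify ((1 + C t * u) * (1 + C t * u)) =
        1 + ((2 * t : ℝ) : ℂ) • complexify u + ((t * t : ℝ) : ℂ) • complexify (u * u) := by
      simp only [smul_eq_C_mul, map_mul, map_add, map_one, map_C, Complex.ofRealHom_eq_coe,
        Complex.ofReal_mul, Complex.ofReal_ofNat, map_ofNat]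
      ring
    rw [e, map_add, map_add, map_smul, map_smul, hu, smul_zero, add_zero, smul_eq_mul] at h
    exact h
  simp only [Complex.le_def, Complex.zero_re, Complex.zero_im, Complex.add_re, Complex.add_im,
    Complex.re_ofReal_mul, Complex.im_ofReal_mul] at key
  have h0 := key 0
  have h1 := key (1 / 2)
  refine Complex.ext ?_ ?_
  · by_contra hne
    rw [Complex.zero_re] at hne
    have := (key (-((Λ 1).re + 1) / (2 * (Λ (complexify u)).re))).1
    field_simp at this
    linarith
  · simp only [Complex.zero_im]
    linarith [h0.2, h1.2]

theorem IsPosDefC.apply_eq_zero_of_nSetC (hΛ : IsPosDefC Λ) {u : MvPolynomial (Fin n) ℝ}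
    (hu : complexify u ∈ nSetC Λ) : Λ (complexify u) = 0 := by
  have : Λ (starC (complexify u) * complexify u) = 0 := hu
  rw [starC_complexify, ← map_mul] at this
  exact hΛ.apply_complexify_eq_zero this

theorem IsPosDefC.isReal_comap (hΛ : IsPosDefC Λ) {I : Ideal (MvPolynomial (Fin n) ℂ)}
    (hI : nSetC Λ = I) : (I.comap complexify).IsReal := by
  intro f s hs hfs
  rw [Ideal.mem_comap, ← SetLike.mem_coe, ← hI] at hfs ⊢
  have h := hΛ.apply_eq_zero_of_nSetC hfs
  change Λ (starC (complexify f) * complexify f) = 0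
  rw [starC_complexify, ← map_mul]
  rw [map_add, map_add] at h
  exact ((add_eq_zero_iff_of_nonneg (hΛ.nonneg_of_isSumSq (IsSumSq.mul_self f))
    (hΛ.nonneg_of_isSumSq hs)).1 h).1

theorem IsPosDefC.eq_vanishingIdealC (hΛ : IsPosDefC Λ) {I : Ideal (MvPolynomial (Fin n) ℂ)}
    (hI : nSetC Λ = I) : I = vanishingIdealC (zeroSetC I) := by
  refine le_antisymm (fun P hP x hx => hx P hP) fun P hP => ?_
  obtain ⟨h, hhP, hh⟩ := exists_complexify_eq_starC_mul_self P
  have hmem : h ∈ I.comap complexify := by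
    refine (hΛ.isReal_comap hI).mem_of_forall_eval_eq_zero fun r hr => ?_
    refine (hh r).2 (hP r fun Q hQ => ?_)
    obtain ⟨q, hqQ, hq⟩ := exists_complexify_eq_starC_mul_self Q
    refine (hq r).1 (hr q ?_)
    rw [Ideal.mem_comap, hqQ]
    exact I.mul_mem_left _ hQ
  rw [Ideal.mem_comap, ← SetLike.mem_coe, ← hI] at hmem
  rw [← SetLike.mem_coe, ← hI]
  change Λ (starC P * P) = 0
  rw [← hhP]
  exact hΛ.apply_eq_zero_of_nSetC hmem

end PositiveFunctional

section DiscreteMeasure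

variable {n : ℕ}

theorem evalC_starC (P : MvPolynomial (Fin n) ℂ) (x : Fin n → ℝ) :
    evalC (starC P) x = starRingEnd ℂ (evalC P x) := by
  have : ((MvPolynomial.aeval fun i => (x i : ℂ)) :
      MvPolynomial (Fin n) ℂ →ₐ[ℂ] ℂ).toRingHom.comp (MvPolynomial.map (starRingEnd ℂ)) =
      (starRingEnd ℂ).comp (MvPolynomial.aeval fun i => (x i : ℂ)).toRingHom :=
    MvPolynomial.ringHom_ext (by simp) (by simp)
  exact RingHom.congr_fun this P

theorem evalC_starC_mul_self (P : MvPolynomial (Fin n) ℂ) (x : Fin n → ℝ) :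
    evalC (starC P * P) x = (Complex.normSq (evalC P x) : ℝ) := by
  rw [Complex.normSq_eq_conj_mul_self, ← evalC_starC]
  simp only [evalC, map_mul]

theorem continuous_evalC (P : MvPolynomial (Fin n) ℂ) : Continuous (evalC P) := by
  unfold evalC
  induction P using MvPolynomial.induction_on with
  | C a => simpa using continuous_const
  | add P Q hP hQ => simpa only [map_add] using hP.fun_add hQ
  | mul_X P i hP =>
    simp only [map_mul, MvPolynomial.aeval_X]
    exact hP.mul (Complex.continuous_ofReal.comp (continuous_apply i))

theorem exists_norm_evalC_le (P : MvPolynomial (Fin n) ℂ) :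
    ∃ (c : ℝ) (d : ℕ), ∀ x, ‖evalC P x‖ ≤ c * (1 + ‖x‖) ^ d := by
  induction P using MvPolynomial.induction_on with
  | C a => exact ⟨‖a‖, 0, fun x => by simp [evalC]⟩
  | add P Q hP hQ =>
    obtain ⟨c, d, h⟩ := hP
    obtain ⟨c', d', h'⟩ := hQ
    refine ⟨|c| + |c'|, max d d', fun x => ?_⟩
    have h1 : (1 : ℝ) ≤ 1 + ‖x‖ := by simp
    have e : evalC (P + Q) x = evalC P x + evalC Q x := by simp [evalC]
    have hle : ∀ (c : ℝ) (k : ℕ), k ≤ max d d' →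
        c * (1 + ‖x‖) ^ k ≤ |c| * (1 + ‖x‖) ^ max d d' := fun c k hk => by
      have := pow_le_pow_right₀ h1 hk
      exact mul_le_mul (le_abs_self c) this (by positivity) (abs_nonneg c)
    rw [e, add_mul]
    exact (norm_add_le _ _).trans (add_le_add ((h x).trans (hle c d (le_max_left _ _)))
      ((h' x).trans (hle c' d' (le_max_right _ _))))
  | mul_X P i hP =>
    obtain ⟨c, d, h⟩ := hP
    refine ⟨c, d + 1, fun x => ?_⟩
    have e : evalC (P * MvPolynomial.X i) x = evalC P x * x i := by simp [evalC]
    have hxi : ‖(x i : ℂ)‖ ≤ 1 + ‖x‖ := by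
      rw [Complex.norm_real]
      exact (norm_le_pi_norm x i).trans (by simp)
    rw [e, norm_mul, pow_succ, ← mul_assoc]
    exact mul_le_mul (h x) hxi (norm_nonneg _) ((norm_nonneg _).trans (h x))

/-- Weights making all polynomials summable along the sequence `z`. -/
noncomputable def decayWeight (z : ℕ → Fin n → ℝ) (k : ℕ) : ℝ :=
  (1 / 2) ^ k * ((1 + ‖z k‖) ^ k)⁻¹

theorem decayWeight_pos (z : ℕ → Fin n → ℝ) (k : ℕ) : 0 < decayWeight z k := by
  unfold decayWeight
  positivity

theorem summable_decayWeight_mul_evalC (z : ℕ → Fin n → ℝ) (P : MvPolynomial (Fin n) ℂ) :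
    Summable fun k => (decayWeight z k : ℂ) * evalC P (z k) := by
  obtain ⟨c, d, h⟩ := exists_norm_evalC_le P
  refine Summable.of_norm_bounded_eventually_nat (g := fun k => |c| * (1 / 2 : ℝ) ^ k)
    ((summable_geometric_of_lt_one (by norm_num) (by norm_num)).mul_left _) ?_
  filter_upwards [Filter.eventually_ge_atTop d] with k hk
  have h1 : (1 : ℝ) ≤ 1 + ‖z k‖ := by simp
  rw [norm_mul, Complex.norm_real, Real.norm_of_nonneg (decayWeight_pos z k).le]
  calc decayWeight z k * ‖evalC P (z k)‖
      ≤ decayWeight z k * (|c| * (1 + ‖z k‖) ^ k) := by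
        refine mul_le_mul_of_nonneg_left ((h _).trans ?_) (decayWeight_pos z k).le
        exact mul_le_mul (le_abs_self c) (pow_le_pow_right₀ h1 hk) (by positivity) (abs_nonneg c)
    _ = |c| * (1 / 2 : ℝ) ^ k := by
        unfold decayWeight
        field_simp

/-- Integration against a discrete measure supported on the sequence `z`. -/
noncomputable def discreteFunctional (z : ℕ → Fin n → ℝ) : MvPolynomial (Fin n) ℂ →ₗ[ℂ] ℂ where
  toFun P := ∑' k, (decayWeight z k : ℂ) * evalC P (z k)
  map_add' P Q := by
    rw [← (summable_decayWeight_mul_evalC z P).tsum_add (summable_decayWeight_mul_evalC z Q)]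
    congr 1
    ext k
    simp only [evalC, map_add]
    ring
  map_smul' a P := by
    rw [RingHom.id_apply, smul_eq_mul, ← tsum_mul_left]
    congr 1
    ext k
    simp only [evalC, map_smul, smul_eq_mul]
    ring

theorem hasSum_discreteFunctional_starC_mul_self (z : ℕ → Fin n → ℝ)
    (P : MvPolynomial (Fin n) ℂ) :
    ∃ s : ℝ, HasSum (fun k => decayWeight z k * Complex.normSq (evalC P (z k))) s ∧
      discreteFunctional z (starC P * P) = s := by
  have h := summable_decayWeight_mul_evalC z (starC P * P)
  simp only [evalC_starC_mul_self, ← Complex.ofReal_mul] at h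
  obtain ⟨s, hs⟩ := Complex.summable_ofReal.1 h
  refine ⟨s, hs, ?_⟩
  simp only [discreteFunctional, LinearMap.coe_mk, AddHom.coe_mk, evalC_starC_mul_self,
    ← Complex.ofReal_mul]
  exact (Complex.hasSum_ofReal.2 hs).tsum_eq

theorem isPosDefC_discreteFunctional (z : ℕ → Fin n → ℝ) : IsPosDefC (discreteFunctional z) := by
  intro P
  obtain ⟨s, hs, h⟩ := hasSum_discreteFunctional_starC_mul_self z P
  rw [h]
  exact Complex.zero_le_real.2
    (hs.nonneg fun k => mul_nonneg (decayWeight_pos z k).le (Complex.normSq_nonneg _))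

theorem mem_nSetC_discreteFunctional (z : ℕ → Fin n → ℝ) (P : MvPolynomial (Fin n) ℂ) :
    P ∈ nSetC (discreteFunctional z) ↔ ∀ k, evalC P (z k) = 0 := by
  obtain ⟨s, hs, h⟩ := hasSum_discreteFunctional_starC_mul_self z P
  have hnonneg : ∀ k, 0 ≤ decayWeight z k * Complex.normSq (evalC P (z k)) := fun k =>
    mul_nonneg (decayWeight_pos z k).le (Complex.normSq_nonneg _)
  change discreteFunctional z (starC P * P) = 0 ↔ _
  rw [h, Complex.ofReal_eq_zero]
  refine ⟨fun h0 k => ?_, fun h0 => ?_⟩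
  · rw [h0, hasSum_zero_iff_of_nonneg hnonneg] at hs
    simpa [(decayWeight_pos z k).ne'] using congrFun hs k
  · simp only [h0, map_zero, mul_zero] at hs
    exact hs.unique hasSum_zero

theorem exists_nSetC_eq_vanishingIdealC {Z : Set (Fin n → ℝ)} (hZ : Z.Nonempty) :
    ∃ Λ : MvPolynomial (Fin n) ℂ →ₗ[ℂ] ℂ, IsPosDefC Λ ∧
      nSetC Λ = (vanishingIdealC Z : Set (MvPolynomial (Fin n) ℂ)) := by
  have : Nonempty Z := hZ.to_subtype
  refine ⟨discreteFunctional fun k => (TopologicalSpace.denseSeq Z k : Fin n → ℝ),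
    isPosDefC_discreteFunctional _, ?_⟩
  ext P
  rw [mem_nSetC_discreteFunctional]
  refine ⟨fun h x hx => ?_, fun h k => h _ (Subtype.coe_prop _)⟩
  have hcont : Continuous fun x : Z => evalC P x := (continuous_evalC P).comp continuous_subtype_val
  have := hcont.ext_on (TopologicalSpace.denseRange_denseSeq Z) continuous_const
    (g := fun _ => (0 : ℂ)) (by rintro _ ⟨k, rfl⟩; exact h k)
  exact congrFun this ⟨x, hx⟩

end DiscreteMeasure

theorem stmt_16 (n : ℕ) (hn : 0 < n) (I : Ideal (MvPolynomial (Fin n) ℂ))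
    (hproper : I ≠ ⊤) (hstar : ∀ P ∈ I, starC P ∈ I) :
    (∃ Z : Set (Fin n → ℝ), I = vanishingIdealC Z) ↔
      (∃ Λ : MvPolynomial (Fin n) ℂ →ₗ[ℂ] ℂ, IsPosDefC Λ ∧
        nSetC Λ = (I : Set (MvPolynomial (Fin n) ℂ))) := by
  constructor
  · rintro ⟨Z, rfl⟩
    refine exists_nSetC_eq_vanishingIdealC (Set.nonempty_iff_ne_empty.2 ?_)
    rintro rfl
    exact hproper ((Ideal.eq_top_iff_one _).2 fun x hx => hx.elim)
  · rintro ⟨Λ, hΛ, hI⟩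
    exact ⟨zeroSetC I, hΛ.eq_vanishingIdealC hI⟩
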